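/- Let ⟨S | R⟩ and ⟨S' | R'⟩ be two finite presentations of the same group Γ (i.e., there is a group isomorphism F(S)/⟨⟨R⟩⟩ ≅ F(S')/⟨⟨R'⟩⟩), and let 𝒞 be a family of groups with bi-invariant metrics. Then D_{(S,R)} ∼ D_{(S',R')}, i.e., D_{(S,R)} ⪯ D_{(S',R')} and D_{(S',R')} ⪯ D_{(S,R)}. -/

import Mathlib

/-- A group equipped with a bi-invariant metric. -/
structure MetricGroup where
  carrier : Type
  [group : Group carrier]
  [metric : MetricSpace carrier]
  dist_left_invariant : ∀ g x y : carrier, dist (g * x) (g * y) = dist x y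
  dist_right_invariant : ∀ g x y : carrier, dist (x * g) (y * g) = dist x y

attribute [instance] MetricGroup.group MetricGroup.metric

/-- defect(φ) = max_{r ∈ R} d(φ(r), 1), where φ also denotes the induced
homomorphism F(S) → G. -/
noncomputable def defect {S : Type} [Fintype S] (R : Finset (FreeGroup S)) {G : MetricGroup}
    (φ : S → G.carrier) : ℝ :=
  ((R.sup fun r => nndist ((FreeGroup.lift φ) r) 1 : NNReal) : ℝ)

/-- dist(φ, ψ) = max_{s ∈ S} d(φ(s), ψ(s)). -/
noncomputable def mapDist {S : Type} [Fintype S] {G : MetricGroup} (φ ψ : S → G.carrier) : ℝ :=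
  ((Finset.univ.sup fun s => nndist (φ s) (ψ s) : NNReal) : ℝ)

/-- HomDist(φ) = inf over homomorphisms π : Γ → G of dist(φ, (π ∘ q)|_S),
where Γ = F(S)/⟨⟨R⟩⟩ and q is the quotient map. -/
noncomputable def homDist {S : Type} [Fintype S] (R : Finset (FreeGroup S)) {G : MetricGroup}
    (φ : S → G.carrier) : ℝ :=
  ⨅ π : (FreeGroup S ⧸ Subgroup.normalClosure (R : Set (FreeGroup S))) →* G.carrier,
    mapDist φ (fun s => π ((QuotientGroup.mk' _) (FreeGroup.of s)))

/-- D(δ) = sup { HomDist(φ) : φ : S → G, G ∈ 𝒞, defect(φ) < δ }, valued in [0, ∞]. -/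
noncomputable def Drate {S : Type} [Fintype S] (𝒞 : Set MetricGroup)
    (R : Finset (FreeGroup S)) (δ : ℝ) : ENNReal :=
  ⨆ (G : MetricGroup) (_ : G ∈ 𝒞) (φ : S → G.carrier) (_ : defect R φ < δ),
    ENNReal.ofReal (homDist R φ)

/-- f ⪯ g for [0,∞]-valued rate functions: there are C > 0 and δ₀ > 0 with
f(δ) ≤ C·g(C·δ) + C·δ for all δ ∈ (0, δ₀]. -/
def PrecedeE (f g : ℝ → ENNReal) : Prop :=
  ∃ C : ℝ, 0 < C ∧ ∃ δ₀ : ℝ, 0 < δ₀ ∧ ∀ δ : ℝ, 0 < δ → δ ≤ δ₀ →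
    f δ ≤ ENNReal.ofReal C * g (C * δ) + ENNReal.ofReal (C * δ)

theorem aux_dist_mul {G : MetricGroup} (a b c d : G.carrier) :
    dist (a * b) (c * d) ≤ dist a c + dist b d := by
  calc dist (a * b) (c * d) ≤ dist (a * b) (c * b) + dist (c * b) (c * d) := dist_triangle _ _ _
    _ = dist a c + dist b d := by rw [G.dist_right_invariant, G.dist_left_invariant]

theorem aux_dist_inv {G : MetricGroup} (a b : G.carrier) :
    dist a⁻¹ b⁻¹ = dist a b := by
  have h1 := G.dist_left_invariant a a⁻¹ b⁻¹
  have h2 := G.dist_right_invariant b (a * a⁻¹) (a * b⁻¹)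
  rw [← h1, ← h2]
  simp [dist_comm]

theorem aux_defect_nonneg {S : Type} [Fintype S] (R : Finset (FreeGroup S)) {G : MetricGroup}
    (φ : S → G.carrier) : 0 ≤ defect R φ := NNReal.coe_nonneg _

theorem aux_mapDist_nonneg {S : Type} [Fintype S] {G : MetricGroup}
    (φ ψ : S → G.carrier) : 0 ≤ mapDist φ ψ := NNReal.coe_nonneg _

theorem aux_le_defect {S : Type} [Fintype S] (R : Finset (FreeGroup S)) {G : MetricGroup}
    (φ : S → G.carrier) (r : FreeGroup S) (hr : r ∈ R) :
    dist (FreeGroup.lift φ r) 1 ≤ defect R φ := by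
  rw [← coe_nndist]
  exact NNReal.coe_le_coe.2 (Finset.le_sup (f := fun r => nndist ((FreeGroup.lift φ) r) 1) hr)

theorem aux_defect_le {S : Type} [Fintype S] (R : Finset (FreeGroup S)) {G : MetricGroup}
    (φ : S → G.carrier) (c : ℝ) (hc : 0 ≤ c)
    (h : ∀ r ∈ R, dist (FreeGroup.lift φ r) 1 ≤ c) : defect R φ ≤ c := by
  lift c to NNReal using hc
  refine NNReal.coe_le_coe.2 (Finset.sup_le fun r hr => ?_)
  exact NNReal.coe_le_coe.1 (h r hr)

theorem aux_le_mapDist {S : Type} [Fintype S] {G : MetricGroup}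
    (φ ψ : S → G.carrier) (s : S) : dist (φ s) (ψ s) ≤ mapDist φ ψ := by
  rw [← coe_nndist]
  exact NNReal.coe_le_coe.2
    (Finset.le_sup (f := fun s => nndist (φ s) (ψ s)) (Finset.mem_univ s))

theorem aux_mapDist_le {S : Type} [Fintype S] {G : MetricGroup}
    (φ ψ : S → G.carrier) (c : ℝ) (hc : 0 ≤ c)
    (h : ∀ s, dist (φ s) (ψ s) ≤ c) : mapDist φ ψ ≤ c := by
  lift c to NNReal using hc
  refine NNReal.coe_le_coe.2 (Finset.sup_le fun r _ => ?_)
  exact NNReal.coe_le_coe.1 (h r)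

/-- Elements of the normal closure are almost trivial, linearly in the defect. -/
theorem aux_normalClosure {S : Type} [Fintype S] (R : Finset (FreeGroup S)) (g : FreeGroup S)
    (hg : g ∈ Subgroup.normalClosure (R : Set (FreeGroup S))) :
    ∃ K : ℝ, 0 ≤ K ∧ ∀ (G : MetricGroup) (φ : S → G.carrier),
      dist (FreeGroup.lift φ g) 1 ≤ K * defect R φ := by
  refine Subgroup.closure_induction (p := fun g _ => ∃ K : ℝ, 0 ≤ K ∧
    ∀ (G : MetricGroup) (φ : S → G.carrier),
      dist (FreeGroup.lift φ g) 1 ≤ K * defect R φ) ?_ ?_ ?_ ?_ hg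
  · intro x hx
    obtain ⟨r, hr, hrx⟩ := Group.mem_conjugatesOfSet_iff.1 hx
    obtain ⟨c, rfl⟩ := isConj_iff.1 hrx
    refine ⟨1, zero_le_one, fun G φ => ?_⟩
    rw [one_mul]
    refine le_trans (le_of_eq ?_) (aux_le_defect R φ r hr)
    have h1 := G.dist_left_invariant (FreeGroup.lift φ c) (FreeGroup.lift φ r) 1
    have h2 := G.dist_right_invariant (FreeGroup.lift φ c)⁻¹
      (FreeGroup.lift φ c * FreeGroup.lift φ r) (FreeGroup.lift φ c * 1)
    rw [← h1, ← h2]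
    simp
  · exact ⟨0, le_rfl, fun G φ => by simp⟩
  · rintro x y _ _ ⟨K, hK, h⟩ ⟨L, hL, h'⟩
    refine ⟨K + L, by positivity, fun G φ => ?_⟩
    have := aux_dist_mul (FreeGroup.lift φ x) (FreeGroup.lift φ y) 1 1
    rw [mul_one] at this
    rw [map_mul]
    linarith [h G φ, h' G φ, add_mul K L (defect R φ)]
  · rintro x _ ⟨K, hK, h⟩
    refine ⟨K, hK, fun G φ => ?_⟩
    have := aux_dist_inv (FreeGroup.lift φ x) 1
    rw [inv_one] at this
    rw [map_inv, this]
    exact h G φ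

/-- Word maps are Lipschitz. -/
theorem aux_word {S : Type} [Fintype S] (g : FreeGroup S) :
    ∃ K : ℝ, 0 ≤ K ∧ ∀ (G : MetricGroup) (φ ψ : S → G.carrier),
      dist (FreeGroup.lift φ g) (FreeGroup.lift ψ g) ≤ K * mapDist φ ψ := by
  induction g using FreeGroup.induction_on with
  | C1 => exact ⟨0, le_rfl, fun G φ ψ => by simp⟩
  | of s => exact ⟨1, zero_le_one, fun G φ ψ => by simpa using aux_le_mapDist φ ψ s⟩
  | inv_of s _ =>
    exact ⟨1, zero_le_one, fun G φ ψ => by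
      simpa [aux_dist_inv] using aux_le_mapDist φ ψ s⟩
  | mul x y hx hy =>
    obtain ⟨K, hK, h⟩ := hx
    obtain ⟨L, hL, h'⟩ := hy
    refine ⟨K + L, by positivity, fun G φ ψ => ?_⟩
    rw [map_mul, map_mul]
    linarith [h G φ ψ, h' G φ ψ, add_mul K L (mapDist φ ψ),
      aux_dist_mul (FreeGroup.lift φ x) (FreeGroup.lift φ y)
        (FreeGroup.lift ψ x) (FreeGroup.lift ψ y)]

theorem aux_precede
    {S S' : Type} [Fintype S] [Fintype S']
    (R : Finset (FreeGroup S)) (R' : Finset (FreeGroup S'))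
    (e : (FreeGroup S ⧸ Subgroup.normalClosure (R : Set (FreeGroup S))) ≃*
         (FreeGroup S' ⧸ Subgroup.normalClosure (R' : Set (FreeGroup S'))))
    (𝒞 : Set MetricGroup) :
    PrecedeE (Drate 𝒞 R) (Drate 𝒞 R') := by
  set N := Subgroup.normalClosure (R : Set (FreeGroup S)) with hN
  set N' := Subgroup.normalClosure (R' : Set (FreeGroup S')) with hN'
  have hw : ∀ s : S, ∃ w : FreeGroup S',
      QuotientGroup.mk' N' w = e (QuotientGroup.mk' N (FreeGroup.of s)) :=
    fun s => QuotientGroup.mk'_surjective N' _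
  have hv : ∀ s : S', ∃ v : FreeGroup S,
      QuotientGroup.mk' N v = e.symm (QuotientGroup.mk' N' (FreeGroup.of s)) :=
    fun s => QuotientGroup.mk'_surjective N _
  choose w hw using hw
  choose v hv using hv
  -- the substitution homomorphism induces the inverse isomorphism
  have hV : ∀ x : FreeGroup S', QuotientGroup.mk' N (FreeGroup.lift v x) =
      e.symm (QuotientGroup.mk' N' x) := by
    have : (QuotientGroup.mk' N).comp (FreeGroup.lift v) =
        e.symm.toMonoidHom.comp (QuotientGroup.mk' N') := by
      ext s
      simpa using hv s
    intro x
    exact DFunLike.congr_fun this x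
  have hmem1 : ∀ r ∈ R', FreeGroup.lift v r ∈ N := by
    intro r hr
    rw [← QuotientGroup.eq_one_iff]
    have h1 : QuotientGroup.mk' N' r = 1 :=
      (QuotientGroup.eq_one_iff r).2 (Subgroup.subset_normalClosure hr)
    have := hV r
    rw [h1, map_one] at this
    exact this
  have hmem2 : ∀ s : S, FreeGroup.of s * (FreeGroup.lift v (w s))⁻¹ ∈ N := by
    intro s
    rw [← QuotientGroup.eq_one_iff]
    have := hV (w s)
    rw [hw, e.symm_apply_apply] at this
    change QuotientGroup.mk' N (FreeGroup.of s * (FreeGroup.lift v (w s))⁻¹) = 1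
    rw [map_mul, map_inv, this, mul_inv_cancel]
  have hK1 : ∀ r : R', ∃ K : ℝ, 0 ≤ K ∧ ∀ (G : MetricGroup) (φ : S → G.carrier),
      dist (FreeGroup.lift φ (FreeGroup.lift v r.1)) 1 ≤ K * defect R φ :=
    fun r => aux_normalClosure R _ (hmem1 r.1 r.2)
  have hK2 := fun s => aux_normalClosure R _ (hmem2 s)
  have hL := fun s => aux_word (w s)
  choose K1 hK1n hK1 using hK1
  choose K2 hK2n hK2 using hK2
  choose L hLn hL using hL
  have s1 := Finset.sum_nonneg (s := Finset.univ) fun i _ => hK1n i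
  have s2 := Finset.sum_nonneg (s := Finset.univ) fun i _ => hK2n i
  have s3 := Finset.sum_nonneg (s := Finset.univ) fun i _ => hLn i
  obtain ⟨C, hC⟩ : ∃ C : ℝ, C = (∑ i, K1 i) + (∑ i, K2 i) + (∑ i, L i) + 1 := ⟨_, rfl⟩
  have hCpos : 0 < C := by linarith
  have c1 : ∀ r, K1 r ≤ C := fun r => by
    linarith [Finset.single_le_sum (fun i _ => hK1n i) (Finset.mem_univ r)]
  have c2 : ∀ r, K2 r ≤ C := fun r => by
    linarith [Finset.single_le_sum (fun i _ => hK2n i) (Finset.mem_univ r)]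
  have c3 : ∀ r, L r ≤ C := fun r => by
    linarith [Finset.single_le_sum (fun i _ => hLn i) (Finset.mem_univ r)]
  refine ⟨C, hCpos, 1, one_pos, fun δ hδ _ => ?_⟩
  refine iSup_le fun G => iSup_le fun hG => iSup_le fun φ => iSup_le fun hφ => ?_
  set ψ : S' → G.carrier := fun s => FreeGroup.lift φ (v s) with hψ
  have hψl : ∀ x, FreeGroup.lift ψ x = FreeGroup.lift φ (FreeGroup.lift v x) := by
    have : FreeGroup.lift ψ = (FreeGroup.lift φ).comp (FreeGroup.lift v) := by
      ext s
      simp [hψ]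
    intro x
    rw [this]
    rfl
  have hd0 := aux_defect_nonneg R φ
  have hdef : defect R' ψ < C * δ := by
    refine lt_of_le_of_lt (aux_defect_le R' ψ (C * defect R φ) (by positivity) ?_)
      (mul_lt_mul_of_pos_left hφ hCpos)
    intro r hr
    rw [hψl]
    exact (hK1 ⟨r, hr⟩ G φ).trans (mul_le_mul_of_nonneg_right (c1 _) hd0)
  have hmain : homDist R φ ≤ C * homDist R' ψ + C * δ := by
    have : (homDist R φ - C * δ) / C ≤ homDist R' ψ := by
      refine le_ciInf fun π' => ?_
      rw [div_le_iff₀ hCpos]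
      set ρ : S' → G.carrier := fun s => π' ((QuotientGroup.mk' _) (FreeGroup.of s)) with hρ
      have hm0 := aux_mapDist_nonneg ψ ρ
      have hbdd : BddBelow (Set.range fun π : (FreeGroup S ⧸ N) →* G.carrier =>
          mapDist φ (fun s => π ((QuotientGroup.mk' _) (FreeGroup.of s)))) :=
        ⟨0, by rintro _ ⟨π, rfl⟩; exact aux_mapDist_nonneg _ _⟩
      have h1 : homDist R φ ≤ mapDist φ (fun s => (π'.comp e.toMonoidHom)
          ((QuotientGroup.mk' _) (FreeGroup.of s))) := ciInf_le hbdd _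
      have hρl : ∀ x, FreeGroup.lift ρ x = π' (QuotientGroup.mk' N' x) := by
        have : FreeGroup.lift ρ = π'.comp (QuotientGroup.mk' N') := by
          ext s
          simp [hρ]
          rfl
        intro x
        rw [this]
        rfl
      have h2 : mapDist φ (fun s => (π'.comp e.toMonoidHom)
          ((QuotientGroup.mk' _) (FreeGroup.of s))) ≤ C * δ + C * mapDist ψ ρ := by
        refine aux_mapDist_le _ _ _ (by positivity) fun s => ?_
        have e1 : (π'.comp e.toMonoidHom) ((QuotientGroup.mk' N) (FreeGroup.of s)) =
            FreeGroup.lift ρ (w s) := by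
          rw [hρl, hw]
          rfl
        rw [e1]
        have t1 : dist (φ s) (FreeGroup.lift ψ (w s)) ≤ C * δ := by
          have a1 := hK2 s G φ
          rw [← G.dist_right_invariant (FreeGroup.lift ψ (w s)), map_mul, map_inv, hψl] at a1
          simp only [FreeGroup.lift_apply_of, inv_mul_cancel_right, one_mul] at a1
          rw [hψl]
          calc _ ≤ _ := a1
            _ ≤ C * defect R φ := mul_le_mul_of_nonneg_right (c2 _) hd0
            _ ≤ C * δ := mul_le_mul_of_nonneg_left hφ.le hCpos.le
        have t2 : dist (FreeGroup.lift ψ (w s)) (FreeGroup.lift ρ (w s)) ≤ C * mapDist ψ ρ :=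
          (hL s G ψ ρ).trans (mul_le_mul_of_nonneg_right (c3 _) hm0)
        exact (dist_triangle _ _ _).trans (add_le_add t1 t2)
      linarith [mul_comm C (mapDist ψ ρ)]
    rw [div_le_iff₀ hCpos] at this
    linarith
  calc ENNReal.ofReal (homDist R φ) ≤ ENNReal.ofReal (C * homDist R' ψ + C * δ) :=
        ENNReal.ofReal_le_ofReal hmain
    _ ≤ ENNReal.ofReal (C * homDist R' ψ) + ENNReal.ofReal (C * δ) := ENNReal.ofReal_add_le
    _ = ENNReal.ofReal C * ENNReal.ofReal (homDist R' ψ) + ENNReal.ofReal (C * δ) := by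
        rw [ENNReal.ofReal_mul hCpos.le]
    _ ≤ _ := by
        gcongr
        exact le_iSup_of_le G (le_iSup_of_le hG (le_iSup_of_le ψ (le_iSup_of_le hdef le_rfl)))

/-- The stability rate does not depend on the finite presentation: if
F(S)/⟨⟨R⟩⟩ ≅ F(S')/⟨⟨R'⟩⟩ then D_{(S,R)} ∼ D_{(S',R')}. -/
theorem rate_independent_of_presentation
    {S S' : Type} [Fintype S] [Fintype S']
    (R : Finset (FreeGroup S)) (R' : Finset (FreeGroup S'))
    (e : (FreeGroup S ⧸ Subgroup.normalClosure (R : Set (FreeGroup S))) ≃*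
         (FreeGroup S' ⧸ Subgroup.normalClosure (R' : Set (FreeGroup S'))))
    (𝒞 : Set MetricGroup) :
    PrecedeE (Drate 𝒞 R) (Drate 𝒞 R') ∧ PrecedeE (Drate 𝒞 R') (Drate 𝒞 R) := by
  exact ⟨aux_precede R R' e 𝒞, aux_precede R' R e.symm 𝒞⟩
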